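/- arXiv:2311.12937 — 2 statements merged into one kernel-verified Lean document; each statement's English description precedes it below -/
import Mathlib

section
/- For every α ∈ (0,1), the sequence n^{1-α} g_n(α) converges as n → ∞, and the convergence is uniform on every interval (α₀, 1) with 0 < α₀ < 1. -/
open Set Filter

/-- The coefficient sequence `g_n(α)` defined by the recurrence
`g_0 = 0`, `g_1 = 1`, `g_{n+2} = (2α g_{n+1} + n g_n)/(n+2)`. -/
noncomputable def g (α : ℝ) : ℕ → ℝ
  | 0 => 0
  | 1 => 1
  | (n + 2) => (2 * α * g α (n + 1) + n * g α n) / (n + 2)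

lemma g_rec (α : ℝ) (n : ℕ) :
    ((n : ℝ) + 2) * g α (n + 2) = 2 * α * g α (n + 1) + n * g α n := by
  have : (n : ℝ) + 2 ≠ 0 := by positivity
  rw [g]; field_simp

lemma g_nonneg {α : ℝ} (h : 0 < α) : ∀ n, 0 ≤ g α n ∧ 0 ≤ g α (n + 1) := by
  intro n
  induction n with
  | zero => simp [g]
  | succ n ih =>
    refine ⟨ih.2, ?_⟩
    obtain ⟨h1, h2⟩ := ih
    rw [g]; positivity

noncomputable def vv (α : ℝ) (n : ℕ) : ℝ := ((n : ℝ) + 1) * g α (n + 1) - n * g α n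
noncomputable def uu (α : ℝ) (n : ℕ) : ℝ := ((n : ℝ) + 1) * g α (n + 1) + n * g α n

lemma v_rec (α : ℝ) : ∀ n : ℕ,
    ((n : ℝ) + 2) * vv α (n + 2) = (n + 1) * vv α n + (2 * α - 1) * vv α (n + 1) := by
  intro n
  have h1 := g_rec α n
  have h2 := g_rec α (n + 1)
  simp only [vv]
  push_cast at *
  have e : n + 1 + 2 = n + 2 + 1 := rfl
  have e' : n + 1 + 1 = n + 2 := rfl
  rw [e, e'] at h2
  rw [e']
  linear_combination ((n : ℝ) + 2) * h2 - (n + 2 - 2 * α) * h1 + (1 - 2 * α) * h1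

lemma v_bd {α : ℝ} (h : 0 < α) (h' : α < 1) : ∀ n, |vv α n| ≤ 1 ∧ |vv α (n + 1)| ≤ 1 := by
  intro n
  induction n with
  | zero =>
    constructor
    · simp [vv, g]
    · simp [vv, g, abs_le]; constructor <;> linarith
  | succ n ih =>
    refine ⟨ih.2, ?_⟩
    obtain ⟨h1, h2⟩ := ih
    have h3 := v_rec α n
    have h4 : |(2 * α - 1) * vv α (n + 1)| ≤ 1 := by
      rw [abs_mul]
      have : |2 * α - 1| ≤ 1 := by rw [abs_le]; constructor <;> linarith
      exact mul_le_one₀ this (abs_nonneg _) h2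
    have hn : (0 : ℝ) ≤ n := n.cast_nonneg
    rw [abs_le] at *
    constructor <;> nlinarith

lemma u_rec (α : ℝ) (n : ℕ) :
    uu α (n + 1) = uu α n * (1 + α / (n + 1)) + α * vv α n / (n + 1) := by
  have h1 := g_rec α n
  have : (n : ℝ) + 1 ≠ 0 := by positivity
  simp only [uu, vv]
  push_cast
  field_simp
  have e' : n + 1 + 1 = n + 2 := rfl
  rw [e']
  linear_combination ((n : ℝ) + 1) * h1

/-- normalised sum, shifted index -/
noncomputable def xx (α : ℝ) (m : ℕ) : ℝ := ((m : ℝ) + 1) ^ (-α) * uu α (m + 1)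

lemma x_nonneg {α : ℝ} (h : 0 < α) (m : ℕ) : 0 ≤ xx α m := by
  have := g_nonneg h (m + 1)
  obtain ⟨h1, h2⟩ := this
  unfold xx uu
  positivity

lemma fac_bd {α : ℝ} (h : 0 < α) (h' : α < 1) (m : ℕ) :
    (1 + α / ((m : ℝ) + 2)) * (((m : ℝ) + 2) ^ (-α) / ((m : ℝ) + 1) ^ (-α)) ≤ 1 ∧
    1 - 1 / ((m : ℝ) + 1) ^ 2 ≤
      (1 + α / ((m : ℝ) + 2)) * (((m : ℝ) + 2) ^ (-α) / ((m : ℝ) + 1) ^ (-α)) := by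
  have hm : (0 : ℝ) ≤ m := m.cast_nonneg
  have p1 : (0 : ℝ) < (m : ℝ) + 1 := by positivity
  have p2 : (0 : ℝ) < (m : ℝ) + 2 := by positivity
  have e1 : ((m : ℝ) + 2) ^ (-α) / ((m : ℝ) + 1) ^ (-α) = (1 + -1 / ((m : ℝ) + 2)) ^ α := by
    have : (1 + -1 / ((m : ℝ) + 2)) = ((m : ℝ) + 1) / (m + 2) := by field_simp; ring
    rw [this, Real.div_rpow p1.le p2.le, Real.rpow_neg p1.le, Real.rpow_neg p2.le]
    field_simp
  have e2 : ((m : ℝ) + 2) ^ (-α) / ((m : ℝ) + 1) ^ (-α) = 1 / (1 + 1 / ((m : ℝ) + 1)) ^ α := by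
    have : (1 + 1 / ((m : ℝ) + 1)) = ((m : ℝ) + 2) / (m + 1) := by field_simp; ring
    rw [this, Real.div_rpow p2.le p1.le, Real.rpow_neg p1.le, Real.rpow_neg p2.le]
    field_simp
  constructor
  · rw [e1]
    have hb : (1 + -1 / ((m : ℝ) + 2)) ^ α ≤ 1 + α * (-1 / ((m : ℝ) + 2)) := by
      apply rpow_one_add_le_one_add_mul_self _ h.le h'.le
      rw [le_div_iff₀ p2]; linarith
    calc _ ≤ (1 + α / ((m : ℝ) + 2)) * (1 + α * (-1 / ((m : ℝ) + 2))) := by gcongr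
      _ = 1 - (α / ((m : ℝ) + 2)) ^ 2 := by ring
      _ ≤ 1 := by nlinarith [sq_nonneg (α / ((m : ℝ) + 2))]
  · rw [e2]
    have hb : (1 + 1 / ((m : ℝ) + 1)) ^ α ≤ 1 + α * (1 / ((m : ℝ) + 1)) := by
      apply rpow_one_add_le_one_add_mul_self _ h.le h'.le
      have : 0 ≤ 1 / ((m : ℝ) + 1) := by positivity
      linarith
    calc _ ≤ (1 + α / ((m : ℝ) + 2)) * (1 / (1 + α * (1 / ((m : ℝ) + 1)))) := by
            have q : (1 + α / ((m : ℝ) + 2)) * (1 / (1 + α * (1 / ((m : ℝ) + 1))))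
              = 1 - α / ((m + 2) * (m + 1 + α)) := by field_simp; ring
            rw [q]
            have : α / (((m : ℝ) + 2) * (m + 1 + α)) ≤ 1 / ((m : ℝ) + 1) ^ 2 := by
              rw [div_le_div_iff₀ (by positivity) (by positivity)]
              nlinarith [mul_nonneg hm h.le, mul_nonneg (mul_nonneg hm hm) (sub_nonneg.2 h'.le), mul_nonneg hm (sub_nonneg.2 h'.le)]
            linarith
      _ ≤ _ := by gcongr

lemma x_step {α : ℝ} (m : ℕ) :
    xx α (m + 1) = xx α m * ((1 + α / ((m : ℝ) + 2)) *
      (((m : ℝ) + 2) ^ (-α) / ((m : ℝ) + 1) ^ (-α))) +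
      ((m : ℝ) + 2) ^ (-α) * (α * vv α (m + 1) / (m + 2)) := by
  have p1 : (0 : ℝ) < ((m : ℝ) + 1) ^ (-α) := by positivity
  unfold xx
  rw [u_rec α (m + 1)]
  push_cast
  have : (m : ℝ) + 1 + 1 = m + 2 := by ring
  rw [this]
  field_simp

lemma err_bd {α α₀ : ℝ} (h0 : 0 < α₀) (h : α₀ < α) (h' : α < 1) (m : ℕ) :
    |((m : ℝ) + 2) ^ (-α) * (α * vv α (m + 1) / (m + 2))| ≤ ((m : ℝ) + 1) ^ (-(1 + α₀)) := by
  have hm : (0 : ℝ) ≤ m := m.cast_nonneg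
  have hα : 0 < α := h0.trans h
  have p1 : (0 : ℝ) < (m : ℝ) + 1 := by positivity
  have p2 : (0 : ℝ) < (m : ℝ) + 2 := by positivity
  have hv := (v_bd hα h' m).2
  have a1 : |α * vv α (m + 1) / (m + 2)| ≤ 1 / (m + 2) := by
    rw [abs_div, abs_mul, abs_of_pos hα, abs_of_pos p2]
    gcongr
    exact mul_le_one₀ h'.le (abs_nonneg _) hv
  calc _ ≤ ((m : ℝ) + 2) ^ (-α) * (1 / (m + 2)) := by
        rw [abs_mul, abs_of_pos (by positivity : 0 < ((m : ℝ) + 2) ^ (-α))]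
        gcongr
    _ = ((m : ℝ) + 2) ^ (-(1 + α)) := by
        rw [show -(1 + α) = -α - 1 by ring, Real.rpow_sub_one p2.ne']; ring
    _ ≤ ((m : ℝ) + 2) ^ (-(1 + α₀)) := by
        apply Real.rpow_le_rpow_of_exponent_le <;> linarith
    _ ≤ _ := by
        apply Real.rpow_le_rpow_of_nonpos p1 <;> linarith

lemma summ {s : ℝ} (hs : 1 < s) : Summable (fun m : ℕ => ((m : ℝ) + 1) ^ (-s)) := by
  have := (summable_nat_add_iff 1).2 (Real.summable_nat_rpow.2 (by linarith : -s < -1))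
  simpa using this

lemma x_bd {α₀ : ℝ} (h0 : 0 < α₀) : ∀ α ∈ Ioo α₀ 1, ∀ m,
    xx α m ≤ 3 + ∑' m : ℕ, ((m : ℝ) + 1) ^ (-(1 + α₀)) := by
  intro α hα m
  have key : xx α m ≤ 3 + ∑ k ∈ Finset.range m, ((k : ℝ) + 1) ^ (-(1 + α₀)) := by
    induction m with
    | zero => simp [xx, uu, g]; linarith [hα.2]
    | succ m ih =>
      rw [Finset.sum_range_succ, x_step]
      have h1 := (fac_bd (h0.trans hα.1) hα.2 m).1
      have h2 := (abs_le.1 (err_bd h0 hα.1 hα.2 m)).2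
      have h3 := mul_le_of_le_one_right (x_nonneg (h0.trans hα.1) m) h1
      linarith
  have := (summ (by linarith : 1 < 1 + α₀)).sum_le_tsum (Finset.range m)
    (fun i _ => by positivity)
  linarith

lemma diff_bd {α₀ : ℝ} (h0 : 0 < α₀) : ∀ m : ℕ, ∀ α ∈ Ioo α₀ 1,
    ‖xx α (m + 1) - xx α m‖ ≤
      (3 + ∑' m : ℕ, ((m : ℝ) + 1) ^ (-(1 + α₀))) * ((m : ℝ) + 1) ^ (-(2 : ℝ))
        + ((m : ℝ) + 1) ^ (-(1 + α₀)) := by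
  intro m α hα
  have hb := x_bd h0 α hα m
  have hx := x_nonneg (h0.trans hα.1) m
  obtain ⟨h1, h2⟩ := fac_bd (h0.trans hα.1) hα.2 m
  have h3 := err_bd h0 hα.1 hα.2 m
  rw [x_step, Real.norm_eq_abs]
  have e : ((m : ℝ) + 1) ^ (-(2 : ℝ)) = 1 / ((m : ℝ) + 1) ^ 2 := by
    rw [Real.rpow_neg (by positivity)]; norm_num
  rw [e]
  generalize (1 + α / ((m : ℝ) + 2)) * (((m : ℝ) + 2) ^ (-α) / ((m : ℝ) + 1) ^ (-α)) = q at *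
  generalize ((m : ℝ) + 2) ^ (-α) * (α * vv α (m + 1) / (m + 2)) = r at *
  have h4 : xx α m * (1 - q) ≤
      (3 + ∑' m : ℕ, ((m : ℝ) + 1) ^ (-(1 + α₀))) * (1 / ((m : ℝ) + 1) ^ 2) :=
    mul_le_mul hb (by linarith) (by linarith) (hx.trans hb)
  have h5 : 0 ≤ xx α m * (1 - q) := mul_nonneg hx (by linarith)
  rw [abs_le] at *
  constructor <;> linarith [h3.1, h3.2]

lemma key_eq {α : ℝ} (m : ℕ) : ((m + 1 : ℕ) : ℝ) ^ (1 - α) * g α (m + 1) =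
    (xx α m - ((m : ℝ) + 1) ^ (-α) * vv α (m + 1)) / 2 := by
  have p1 : (0 : ℝ) < (m : ℝ) + 1 := by positivity
  unfold xx uu vv
  push_cast
  rw [show 1 - α = -α + 1 by ring, Real.rpow_add_one p1.ne']
  ring

noncomputable def LL (α : ℝ) : ℝ := (xx α 0 + ∑' k : ℕ, (xx α (k + 1) - xx α k)) / 2

lemma unif {α₀ : ℝ} (h0 : 0 < α₀) :
    TendstoUniformlyOn (fun (n : ℕ) (α : ℝ) => (n : ℝ) ^ (1 - α) * g α n) LL
          atTop (Set.Ioo α₀ 1) := by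
  have hs := ((summ (by norm_num : (1 : ℝ) < 2)).mul_left
    (3 + ∑' m : ℕ, ((m : ℝ) + 1) ^ (-(1 + α₀)))).add (summ (by linarith : 1 < 1 + α₀))
  have hu := tendstoUniformlyOn_tsum_nat hs (diff_bd h0)
  rw [Metric.tendstoUniformlyOn_iff] at *
  intro ε hε
  have ht : Tendsto (fun m : ℕ => ((m : ℝ) + 1) ^ (-α₀)) atTop (nhds 0) :=
    (tendsto_rpow_neg_atTop h0).comp
      (tendsto_atTop_add_const_right _ _ tendsto_natCast_atTop_atTop)
  have hall := (hu ε hε).and (ht.eventually (gt_mem_nhds hε))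
  rw [eventually_atTop] at *
  obtain ⟨N, hN⟩ := hall
  refine ⟨N + 1, fun n hn α hα => ?_⟩
  obtain ⟨m, rfl⟩ : ∃ m, n = m + 1 := ⟨n - 1, by omega⟩
  obtain ⟨h1, h2⟩ := hN m (by omega)
  have h1 := h1 α hα
  rw [Finset.sum_range_sub (fun k => xx α k)] at h1
  rw [key_eq, LL]
  have hm : (0 : ℝ) ≤ m := m.cast_nonneg
  have h3 : |((m : ℝ) + 1) ^ (-α) * vv α (m + 1)| < ε := by
    refine lt_of_le_of_lt ?_ h2
    rw [abs_mul, abs_of_pos (by positivity : 0 < ((m : ℝ) + 1) ^ (-α))]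
    refine (mul_le_of_le_one_right (by positivity) (v_bd (h0.trans hα.1) hα.2 m).2).trans ?_
    apply Real.rpow_le_rpow_of_exponent_le <;> linarith [hα.1]
  rw [Real.dist_eq, abs_lt] at *
  constructor <;> linarith [h1.1, h1.2, h3.1, h3.2]

theorem stmt8 :
    ∃ L : ℝ → ℝ,
      (∀ α ∈ Set.Ioo (0:ℝ) 1,
        Tendsto (fun n : ℕ => (n : ℝ) ^ (1 - α) * g α n) atTop (nhds (L α))) ∧
      (∀ α₀ : ℝ, 0 < α₀ → α₀ < 1 →
        TendstoUniformlyOn (fun (n : ℕ) (α : ℝ) => (n : ℝ) ^ (1 - α) * g α n) L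
          atTop (Set.Ioo α₀ 1)) := by
  refine ⟨LL, fun α hα => ?_, fun α₀ h0 _ => unif h0⟩
  exact (unif (half_pos hα.1)).tendsto_at ⟨by linarith [hα.1], hα.2⟩
end

section
/- For α, β ∈ (0,1) with α + β > 1, the limit as r → 1⁻ of (1 - r)^{α+β-1} · (f_α * f_β)(r) equals 2^{α+β-2} Γ(α+β-1) / (Γ(α+1) Γ(β+1)). -/
open Set Filter Real

/-- The Hadamard product f_α * f_β restricted to the real interval. -/
noncomputable def hadamardR (α β : ℝ) (r : ℝ) : ℝ :=
  ∑' n : ℕ, g α n * g β n * r ^ n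

/-- Real beta integral as a coercion. -/
lemma beta_real (u v : ℝ) :
    ((∫ x in (0:ℝ)..1, x ^ (u - 1) * (1 - x) ^ (v - 1) : ℝ) : ℂ) = Complex.betaIntegral u v := by
  rw [Complex.betaIntegral, ← intervalIntegral.integral_ofReal]
  apply intervalIntegral.integral_congr
  intro x hx
  rw [Set.uIcc_of_le zero_le_one] at hx
  have h1 : 0 ≤ 1 - x := by linarith [hx.2]
  simp only [Complex.ofReal_mul]
  rw [Complex.ofReal_cpow hx.1, Complex.ofReal_cpow h1]
  push_cast
  rfl

lemma beta_gamma {α : ℝ} (hα : α ∈ Set.Ioo (0:ℝ) 1) :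
    ∫ x in (0:ℝ)..1, x ^ (-α) * (1 - x) ^ α = Real.Gamma (1 - α) * Real.Gamma (α + 1) := by
  have h := beta_real (1 - α) (α + 1)
  rw [Complex.betaIntegral_eq_Gamma_mul_div _ _ (by simpa using hα.2)
    (by simp; linarith [hα.1]), ← Complex.ofReal_add, Complex.Gamma_ofReal,
    Complex.Gamma_ofReal, Complex.Gamma_ofReal] at h
  have e1 : 1 - α - 1 = -α := by ring
  have e2 : α + 1 - 1 = α := by ring
  have e3 : 1 - α + (α + 1) = 2 := by ring
  rw [e1, e2, e3, Real.Gamma_two] at h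
  norm_cast at h
  rw [h]; simp

lemma beta_seq {α : ℝ} (hα : α ∈ Set.Ioo (0:ℝ) 1) (n : ℕ) :
    (n:ℝ) ^ (1 - α) * ∫ x in (0:ℝ)..1, x ^ (-α) * (1 - x) ^ n = Real.GammaSeq (1 - α) n := by
  have h := beta_real (1 - α) (n + 1)
  have h2 : ((n + 1 : ℝ) : ℂ) = (n : ℂ) + 1 := by push_cast; rfl
  rw [h2, Complex.betaIntegral_eval_nat_add_one_right (by simpa using hα.2)] at h
  have e1 : 1 - α - 1 = -α := by ring
  have e2 : (n:ℝ) + 1 - 1 = n := by ring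
  rw [e1, e2] at h
  simp only [Real.rpow_natCast] at h
  norm_cast at h
  rw [h, Real.GammaSeq]
  ring

lemma w_int {α : ℝ} (hα : α ∈ Set.Ioo (0:ℝ) 1) (a b : ℝ) :
    IntervalIntegrable (fun t : ℝ => t ^ (-α) * (1 - t) ^ α) MeasureTheory.volume a b := by
  apply IntervalIntegrable.mul_continuousOn
  · exact intervalIntegral.intervalIntegrable_rpow' (by linarith [hα.2])
  · apply ContinuousOn.rpow_const (by fun_prop)
    intro x _; right; exact hα.1.le

/-- Moments. -/
noncomputable def mom (α : ℝ) (n : ℕ) : ℝ :=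
  ∫ t in (0:ℝ)..1, (1 - 2 * t) ^ n * (t ^ (-α) * (1 - t) ^ α)

lemma mom_int {α : ℝ} (hα : α ∈ Set.Ioo (0:ℝ) 1) (n : ℕ) (a b : ℝ) :
    IntervalIntegrable (fun t : ℝ => (1 - 2 * t) ^ n * (t ^ (-α) * (1 - t) ^ α))
      MeasureTheory.volume a b :=
  (w_int hα a b).continuousOn_mul (by fun_prop)

lemma mom_deriv {α : ℝ} (n : ℕ) {t : ℝ} (ht : t ∈ Set.Ioo (0:ℝ) 1) :
    HasDerivAt (fun t : ℝ => (1 - 2 * t) ^ n * (t ^ (1 - α) * (1 - t) ^ (α + 1)))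
      ((-(2 * n * (1 - 2 * t) ^ (n - 1)) * (t * (1 - t))
        + (1 - 2 * t) ^ n * ((1 - 2 * t) - α)) * (t ^ (-α) * (1 - t) ^ α)) t := by
  have h0 : t ≠ 0 := ht.1.ne'
  have h1 : 1 - t ≠ 0 := by linarith [ht.2]
  have d1 : HasDerivAt (fun t : ℝ => (1 - 2 * t)) (-2) t := by
    simpa using ((hasDerivAt_id t).const_mul 2).const_sub 1
  have d2 : HasDerivAt (fun t : ℝ => (1 - t)) (-1) t := by
    simpa using (hasDerivAt_id t).const_sub 1
  have d3 := (Real.hasDerivAt_rpow_const (x := t) (p := 1 - α) (Or.inl h0))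
  have d4 := d2.rpow_const (p := α + 1) (Or.inl h1)
  refine ((d1.pow n).mul (d3.mul d4)).congr_deriv ?_
  have e1 : 1 - α - 1 = -α := by ring
  have e2 : α + 1 - 1 = α := by ring
  rw [e1, e2]
  simp only [Pi.mul_apply, Pi.pow_apply]
  rw [show 1 - α = -α + 1 by ring, Real.rpow_add_one h0, Real.rpow_add_one h1]
  ring

lemma mom_rec0 {α : ℝ} (hα : α ∈ Set.Ioo (0:ℝ) 1) (n : ℕ) :
    ∫ t in (0:ℝ)..1, ((-(2 * n * (1 - 2 * t) ^ (n - 1)) * (t * (1 - t))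
        + (1 - 2 * t) ^ n * ((1 - 2 * t) - α)) * (t ^ (-α) * (1 - t) ^ α)) = 0 := by
  rw [intervalIntegral.integral_eq_sub_of_hasDerivAt_of_le zero_le_one ?_
    (fun t ht => mom_deriv n ht) ((w_int hα 0 1).continuousOn_mul (by fun_prop))]
  · have a1 : (0:ℝ) ^ (1 - α) = 0 := Real.zero_rpow (by linarith [hα.2])
    have a2 : (1 - 1:ℝ) ^ (α + 1) = 0 := by
      rw [sub_self]; exact Real.zero_rpow (by linarith [hα.1])
    rw [a1, a2]; simp
  · apply ContinuousOn.mul (by fun_prop)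
    apply ContinuousOn.mul
    · apply ContinuousOn.rpow_const (by fun_prop)
      intro x _; right; linarith [hα.2]
    · apply ContinuousOn.rpow_const (by fun_prop)
      intro x _; right; linarith [hα.1]

lemma mom_rec1 {α : ℝ} (hα : α ∈ Set.Ioo (0:ℝ) 1) : mom α 1 = α * mom α 0 := by
  have h := mom_rec0 hα 0
  have : mom α 1 - α * mom α 0 = 0 := by
    rw [← h, mom, mom, ← intervalIntegral.integral_const_mul,
      ← intervalIntegral.integral_sub (mom_int hα 1 0 1) ((mom_int hα 0 0 1).const_mul α)]
    congr 1; ext t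
    simp; ring
  linarith

lemma mom_rec {α : ℝ} (hα : α ∈ Set.Ioo (0:ℝ) 1) (n : ℕ) :
    (n + 3) * mom α (n + 2) = 2 * α * mom α (n + 1) + (n + 1) * mom α n := by
  have h := mom_rec0 hα (n + 1)
  have : ((n + 3) / 2 * mom α (n + 2) - α * mom α (n + 1)) - (n + 1) / 2 * mom α n = 0 := by
    rw [← h, mom, mom, mom, ← intervalIntegral.integral_const_mul,
      ← intervalIntegral.integral_const_mul, ← intervalIntegral.integral_const_mul,
      ← intervalIntegral.integral_sub ((mom_int hα _ 0 1).const_mul _)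
        ((mom_int hα _ 0 1).const_mul α),
      ← intervalIntegral.integral_sub (((mom_int hα _ 0 1).const_mul _).sub
        ((mom_int hα _ 0 1).const_mul α)) ((mom_int hα _ 0 1).const_mul _)]
    congr 1; ext t
    simp only [Nat.add_sub_cancel]
    push_cast
    ring
  linarith

lemma g_eq {α : ℝ} (hα : α ∈ Set.Ioo (0:ℝ) 1) (n : ℕ) :
    g α (n + 1) = mom α n / (Real.Gamma (1 - α) * Real.Gamma (α + 1)) := by
  have hc : Real.Gamma (1 - α) * Real.Gamma (α + 1) ≠ 0 :=
    (mul_pos (Real.Gamma_pos_of_pos (by linarith [hα.2]))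
      (Real.Gamma_pos_of_pos (by linarith [hα.1]))).ne'
  have h0 : mom α 0 = Real.Gamma (1 - α) * Real.Gamma (α + 1) := by
    rw [← beta_gamma hα, mom]; simp
  induction n using Nat.twoStepInduction with
  | zero => rw [h0, div_self hc]; simp [g]
  | one => rw [mom_rec1 hα, h0, mul_div_assoc, div_self hc]; simp [g]
  | more n ih1 ih2 =>
    rw [g, ih1, ih2]
    have := mom_rec hα n
    have h3 : (n:ℝ) + 3 ≠ 0 := by positivity
    have : mom α (n + 2) = (2 * α * mom α (n + 1) + (n + 1) * mom α n) / (n + 3) := by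
      rw [← this]; field_simp
    rw [this]
    push_cast
    have h4 : (n:ℝ) + 1 + 2 ≠ 0 := by positivity
    field_simp
    ring

lemma half_int {α : ℝ} (n : ℕ) :
    ∫ t in (0:ℝ)..(1/2), (1 - 2 * t) ^ n * t ^ (-α)
      = 2 ^ (α - 1) * ∫ x in (0:ℝ)..1, x ^ (-α) * (1 - x) ^ n := by
  have h := intervalIntegral.integral_comp_mul_left (a := 0) (b := 1/2)
    (fun x : ℝ => x ^ (-α) * (1 - x) ^ n) (two_ne_zero (α := ℝ))
  norm_num at h
  have e : (2:ℝ) ^ (α - 1) = 2 ^ α * (1 / 2) := by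
    rw [Real.rpow_sub_one two_ne_zero]; ring
  rw [e, mul_assoc, ← h, ← intervalIntegral.integral_const_mul]
  apply intervalIntegral.integral_congr
  intro t ht
  rw [Set.uIcc_of_le (by norm_num)] at ht
  simp only
  rw [Real.mul_rpow (by norm_num) ht.1, Real.rpow_neg (by norm_num : (0:ℝ) ≤ 2)]
  have : (2:ℝ) ^ α ≠ 0 := by positivity
  field_simp

lemma bound_left (n : ℕ) : ∫ t in (0:ℝ)..(1/2), (1 - 2 * t) ^ n = 1 / (2 * (n + 1)) := by
  have h := intervalIntegral.integral_comp_sub_mul (a := 0) (b := 1/2)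
    (fun x : ℝ => x ^ n) (two_ne_zero (α := ℝ)) 1
  norm_num at h
  norm_num
  rw [h]; ring

lemma bound_right (n : ℕ) : ∫ t in (1/2:ℝ)..1, (2 * t - 1) ^ n = 1 / (2 * (n + 1)) := by
  have h := intervalIntegral.integral_comp_mul_sub (a := 1/2) (b := 1)
    (fun x : ℝ => x ^ n) (two_ne_zero (α := ℝ)) 1
  norm_num at h
  norm_num
  rw [h]; ring

lemma mom_err {α : ℝ} (hα : α ∈ Set.Ioo (0:ℝ) 1) (n : ℕ) :
    |mom α n - 2 ^ (α - 1) * ∫ x in (0:ℝ)..1, x ^ (-α) * (1 - x) ^ n| ≤ 2 / (n + 1) := by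
  rw [← half_int, mom, ← intervalIntegral.integral_add_adjacent_intervals (mom_int hα n 0 (1/2))
    (mom_int hα n (1/2) 1), add_sub_right_comm]
  have hi : IntervalIntegrable (fun t : ℝ => (1 - 2 * t) ^ n * t ^ (-α))
      MeasureTheory.volume 0 (1/2) :=
    (intervalIntegral.intervalIntegrable_rpow' (by linarith [hα.2])).continuousOn_mul
      (by fun_prop)
  rw [← intervalIntegral.integral_sub (mom_int hα n 0 (1/2)) hi]
  have A : ‖∫ t in (0:ℝ)..(1/2), ((1 - 2 * t) ^ n * (t ^ (-α) * (1 - t) ^ α)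
      - (1 - 2 * t) ^ n * t ^ (-α))‖ ≤ ∫ t in (0:ℝ)..(1/2), (1 - 2 * t) ^ n := by
    apply intervalIntegral.norm_integral_le_of_norm_le (by norm_num) _
      (Continuous.intervalIntegrable (by fun_prop) _ _)
    refine Filter.Eventually.of_forall fun t ht => ?_
    have h0 : 0 < t := ht.1
    have h1 : t ≤ 1 / 2 := ht.2
    have p : 0 ≤ (1 - 2 * t) ^ n := pow_nonneg (by linarith) _
    have q : t ^ (-α) * t ≤ 1 := by
      rw [← Real.rpow_add_one h0.ne']
      exact Real.rpow_le_one h0.le (by linarith) (by linarith [hα.2])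
    have q0 : 0 < t ^ (-α) := Real.rpow_pos_of_pos h0 _
    have r1 : (1 - t) ^ α ≤ 1 := Real.rpow_le_one (by linarith) (by linarith) hα.1.le
    have r2 : 1 - t ≤ (1 - t) ^ α := by
      have := Real.rpow_le_rpow_of_exponent_ge (x := 1 - t) (by linarith) (by linarith) hα.2.le
      simpa using this
    have e : (1 - 2 * t) ^ n * (t ^ (-α) * (1 - t) ^ α) - (1 - 2 * t) ^ n * t ^ (-α)
      = (1 - 2 * t) ^ n * (t ^ (-α) * ((1 - t) ^ α - 1)) := by ring
    rw [e, Real.norm_eq_abs, abs_mul, abs_of_nonneg p]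
    apply mul_le_of_le_one_right p
    rw [abs_mul, abs_of_pos q0]
    refine le_trans (mul_le_mul_of_nonneg_left (b := |(1 - t) ^ α - 1|) (c := t) ?_ q0.le) q
    rw [abs_le]; constructor <;> linarith
  have B : ‖∫ t in (1/2:ℝ)..1, ((1 - 2 * t) ^ n * (t ^ (-α) * (1 - t) ^ α))‖
      ≤ ∫ t in (1/2:ℝ)..1, 2 * (2 * t - 1) ^ n := by
    apply intervalIntegral.norm_integral_le_of_norm_le (by norm_num) _
      (Continuous.intervalIntegrable (by fun_prop) _ _)
    refine Filter.Eventually.of_forall fun t ht => ?_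
    have h0 : 1 / 2 < t := ht.1
    have h1 : t ≤ 1 := ht.2
    have q0 : 0 < t ^ (-α) := Real.rpow_pos_of_pos (by linarith) _
    have r1 : (1 - t) ^ α ≤ 1 := Real.rpow_le_one (by linarith) (by linarith) hα.1.le
    have r0 : 0 ≤ (1 - t) ^ α := Real.rpow_nonneg (by linarith) _
    have q1 : t ^ (-α) ≤ 2 := by
      rw [Real.rpow_neg (by linarith)]
      have : t ≤ t ^ α := by
        have := Real.rpow_le_rpow_of_exponent_ge (x := t) (by linarith) (by linarith) hα.2.le
        simpa using this
      rw [inv_le_comm₀ (by linarith) (by norm_num)]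
      linarith
    rw [Real.norm_eq_abs, abs_mul, abs_pow, abs_of_nonpos (by linarith : 1 - 2 * t ≤ 0),
      abs_of_nonneg (by positivity), mul_comm, neg_sub]
    apply mul_le_mul_of_nonneg_right _ (pow_nonneg (by linarith) _)
    nlinarith
  rw [bound_left] at A
  rw [intervalIntegral.integral_const_mul, bound_right] at B
  refine (abs_add_le _ _).trans ((add_le_add A B).trans ?_)
  have : (0:ℝ) < n + 1 := by positivity
  rw [show (1:ℝ) / (2 * (n + 1)) + 2 * (1 / (2 * (n + 1))) = (3 / 2) / (n + 1) by field_simp; norm_num]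
  gcongr; norm_num

lemma mom_lim {α : ℝ} (hα : α ∈ Set.Ioo (0:ℝ) 1) :
    Tendsto (fun n : ℕ => (n:ℝ) ^ (1 - α) * mom α n) atTop
      (nhds (2 ^ (α - 1) * Real.Gamma (1 - α))) := by
  have h1 := (Real.GammaSeq_tendsto_Gamma (1 - α)).const_mul ((2:ℝ) ^ (α - 1))
  have h2 : Tendsto (fun n : ℕ => (n:ℝ) ^ (1 - α) * mom α n
      - 2 ^ (α - 1) * Real.GammaSeq (1 - α) n) atTop (nhds 0) := by
    have h3 : Tendsto (fun n : ℕ => 2 * (n:ℝ) ^ (-α)) atTop (nhds 0) := by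
      simpa using ((tendsto_rpow_neg_atTop hα.1).comp tendsto_natCast_atTop_atTop).const_mul 2
    apply squeeze_zero_norm' _ h3
    filter_upwards [eventually_gt_atTop 0] with n hn
    have hn' : (0:ℝ) < n := by exact_mod_cast hn
    rw [← beta_seq hα, mul_left_comm, ← mul_sub, Real.norm_eq_abs, abs_mul,
      abs_of_nonneg (by positivity)]
    refine (mul_le_mul_of_nonneg_left (mom_err hα n) (by positivity)).trans ?_
    rw [show 1 - α = -α + 1 by ring, Real.rpow_add_one hn'.ne', mul_div_assoc', div_le_iff₀ (by positivity)]
    have := Real.rpow_pos_of_pos hn' (-α)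
    nlinarith
  simpa using h2.add h1

lemma g_lim {α : ℝ} (hα : α ∈ Set.Ioo (0:ℝ) 1) :
    Tendsto (fun n : ℕ => (n:ℝ) ^ (1 - α) * g α (n + 1)) atTop
      (nhds (2 ^ (α - 1) / Real.Gamma (α + 1))) := by
  have hc : Real.Gamma (1 - α) ≠ 0 := (Real.Gamma_pos_of_pos (by linarith [hα.2])).ne'
  have hd : Real.Gamma (α + 1) ≠ 0 := (Real.Gamma_pos_of_pos (by linarith [hα.1])).ne'
  have h := (mom_lim hα).div_const (Real.Gamma (1 - α) * Real.Gamma (α + 1))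
  convert h using 1
  · ext n; rw [g_eq hα]; ring
  · congr 1; field_simp

/-- Coefficients of `(1-x)^(-s)`. -/
noncomputable def dco (s : ℝ) (n : ℕ) : ℝ := Ring.choose (s + n - 1) n

lemma dco_eq (s : ℝ) (n : ℕ) :
    dco s n = (∏ j ∈ Finset.range n, (s + j)) / n.factorial := by
  have h : (n.factorial : ℝ) * dco s n = ∏ j ∈ Finset.range n, (s + j) := by
    rw [dco, Ring.choose, show s + n - 1 - n + 1 = s by ring, ← nsmul_eq_mul,
      Ring.factorial_nsmul_multichoose_eq_ascPochhammer, Polynomial.ascPochhammer_smeval_eq_eval]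
    induction n with
    | zero => simp
    | succ n ih => rw [ascPochhammer_succ_eval, ih, Finset.prod_range_succ]
  rw [← h]; field_simp

lemma dco_pos {s : ℝ} (hs : 0 < s) (n : ℕ) : 0 < dco s n := by
  rw [dco_eq]
  apply div_pos _ (by positivity)
  exact Finset.prod_pos fun j _ => by positivity

lemma dco_hasSum (s : ℝ) {r : ℝ} (h0 : 0 ≤ r) (h1 : r < 1) :
    HasSum (fun n => dco s n * r ^ n) (1 / (1 - r) ^ s) := by
  have h := (Real.one_div_one_sub_rpow_hasFPowerSeriesOnBall_zero s).hasSum (y := r) (by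
    simp [enorm_eq_nnnorm, ← NNReal.coe_lt_one, abs_of_nonneg h0, h1])
  simp only [FormalMultilinearSeries.ofScalars_apply_eq, zero_add, smul_eq_mul] at h
  exact h

lemma dco_lim {s : ℝ} (hs : 0 < s) :
    Tendsto (fun n : ℕ => (n:ℝ) ^ (1 - s) * dco s n) atTop (nhds (1 / Real.Gamma s)) := by
  have h1 := (Real.GammaSeq_tendsto_Gamma s).inv₀ (Real.Gamma_pos_of_pos hs).ne'
  have h2 : Tendsto (fun n : ℕ => (n:ℝ) / (n + s)) atTop (nhds 1) :=
    tendsto_natCast_div_add_atTop s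
  have h := h2.mul h1
  rw [one_mul, ← one_div] at h
  refine h.congr' ?_
  filter_upwards [eventually_gt_atTop 0] with n hn
  have hn' : (0:ℝ) < n := by exact_mod_cast hn
  rw [dco_eq, Real.GammaSeq, Finset.prod_range_succ, Real.rpow_sub hn', Real.rpow_one]
  have : (n:ℝ) ^ s ≠ 0 := by positivity
  have : (n.factorial : ℝ) ≠ 0 := by positivity
  have : n + s ≠ 0 := by positivity
  rw [add_comm s (n:ℝ)]
  field_simp

lemma abel {s L : ℝ} (hs : 0 < s) (a : ℕ → ℝ)
    (ha : Tendsto (fun n => a n / dco s n) atTop (nhds L)) :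
    Tendsto (fun r : ℝ => (1 - r) ^ s * ∑' n, a n * r ^ n) (nhdsWithin 1 (Set.Iio 1))
      (nhds L) := by
  rw [Metric.tendsto_nhds]
  intro ε hε
  obtain ⟨N, hN⟩ := Filter.eventually_atTop.1 (Metric.tendsto_nhds.1 ha (ε / 2) (half_pos hε))
  have hb : ∀ n, N ≤ n → |a n - L * dco s n| ≤ ε / 2 * dco s n := by
    intro n hn
    have hd := dco_pos hs n
    have := (hN n hn).le
    rw [Real.dist_eq] at this
    have e : a n - L * dco s n = (a n / dco s n - L) * dco s n := by field_simp
    rw [e, abs_mul, abs_of_pos hd]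
    gcongr
  set C := ∑ n ∈ Finset.range N, |a n - L * dco s n| with hC
  have hlim : Tendsto (fun r : ℝ => C * (1 - r) ^ s) (nhdsWithin 1 (Set.Iio 1)) (nhds 0) := by
    have hc : Continuous (fun r : ℝ => C * (1 - r) ^ s) :=
      continuous_const.mul ((by fun_prop : Continuous fun r : ℝ => 1 - r).rpow_const
        fun _ => Or.inr hs.le)
    have := (hc.tendsto 1).mono_left (nhdsWithin_le_nhds (s := Set.Iio 1))
    simpa [Real.zero_rpow hs.ne'] using this
  have hev := hlim.eventually (gt_mem_nhds (half_pos hε))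
  have hpos : ∀ᶠ r in nhdsWithin (1:ℝ) (Set.Iio 1), 0 < r :=
    nhdsWithin_le_nhds (lt_mem_nhds one_pos)
  filter_upwards [hev, hpos, self_mem_nhdsWithin] with r h1 h0 hr
  have hr : r < 1 := hr
  have hS := dco_hasSum s h0.le hr
  have hq : 0 < (1 - r) ^ s := Real.rpow_pos_of_pos (by linarith) _
  -- pointwise bound
  have hbd : ∀ n, ‖(a n - L * dco s n) * r ^ n‖ ≤
      (if n ∈ Finset.range N then |a n - L * dco s n| else 0) + ε / 2 * (dco s n * r ^ n) := by
    intro n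
    have hd := dco_pos hs n
    have hrn : 0 ≤ r ^ n := by positivity
    have hrn1 : r ^ n ≤ 1 := pow_le_one₀ h0.le hr.le
    rw [norm_mul, Real.norm_eq_abs, Real.norm_eq_abs, abs_of_nonneg hrn]
    split_ifs with hm
    · have : 0 ≤ ε / 2 * (dco s n * r ^ n) := by positivity
      nlinarith [abs_nonneg (a n - L * dco s n)]
    · have := hb n (by simpa using hm)
      rw [zero_add, ← mul_assoc]
      gcongr
  have hfin : HasSum (fun n => if n ∈ Finset.range N then |a n - L * dco s n| else 0) C := by
    have := hasSum_sum_of_ne_finset_zero (L := SummationFilter.unconditional ℕ) (s := Finset.range N)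
      (f := fun n => if n ∈ Finset.range N then |a n - L * dco s n| else 0)
      (fun b hb => by simp only [hb, if_false])
    convert this using 1
    rw [hC]
    exact Finset.sum_congr rfl fun x hx => by rw [if_pos hx]
  have hB := hfin.add (hS.mul_left (ε / 2))
  have hsum : Summable (fun n => (a n - L * dco s n) * r ^ n) :=
    Summable.of_norm_bounded hB.summable hbd
  have hle : ‖∑' n, (a n - L * dco s n) * r ^ n‖ ≤ C + ε / 2 * (1 / (1 - r) ^ s) :=
    tsum_of_norm_bounded hB hbd
  have htot : ∑' n, a n * r ^ n
      = ∑' n, (a n - L * dco s n) * r ^ n + L * (1 / (1 - r) ^ s) := by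
    rw [← (hsum.hasSum.add (hS.mul_left L)).tsum_eq]
    congr 1; ext n; ring
  rw [htot, Real.dist_eq]
  have e : (1 - r) ^ s * (∑' n, (a n - L * dco s n) * r ^ n + L * (1 / (1 - r) ^ s)) - L
      = (1 - r) ^ s * ∑' n, (a n - L * dco s n) * r ^ n := by field_simp; ring
  rw [e, abs_mul, abs_of_pos hq]
  rw [Real.norm_eq_abs] at hle
  calc _ ≤ (1 - r) ^ s * (C + ε / 2 * (1 / (1 - r) ^ s)) := by gcongr
    _ = C * (1 - r) ^ s + ε / 2 := by field_simp
    _ < ε := by linarith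

theorem stmt11 (α β : ℝ) (hα : α ∈ Set.Ioo (0:ℝ) 1) (hβ : β ∈ Set.Ioo (0:ℝ) 1)
    (hαβ : 1 < α + β) :
    Tendsto (fun r : ℝ => (1 - r) ^ (α + β - 1) * hadamardR α β r)
      (nhdsWithin 1 (Set.Iio 1))
      (nhds ((2 : ℝ) ^ (α + β - 2) * Real.Gamma (α + β - 1) /
        (Real.Gamma (α + 1) * Real.Gamma (β + 1)))) := by
  have hs : 0 < α + β - 1 := by linarith
  have hG := Real.Gamma_pos_of_pos hs
  have hlim : Tendsto (fun n => (g α (n + 1) * g β (n + 1)) / dco (α + β - 1) n) atTop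
      (nhds ((2 : ℝ) ^ (α + β - 2) * Real.Gamma (α + β - 1) /
        (Real.Gamma (α + 1) * Real.Gamma (β + 1)))) := by
    have h := ((g_lim hα).mul (g_lim hβ)).div (dco_lim hs) (one_div_pos.2 hG).ne'
    have e : (2:ℝ) ^ (α + β - 2) = 2 ^ (α - 1) * 2 ^ (β - 1) := by
      rw [← Real.rpow_add two_pos]; congr 1; ring
    rw [e]
    have e2 : (2:ℝ) ^ (α - 1) * 2 ^ (β - 1) * Real.Gamma (α + β - 1) /
        (Real.Gamma (α + 1) * Real.Gamma (β + 1)) = 2 ^ (α - 1) / Real.Gamma (α + 1) *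
        (2 ^ (β - 1) / Real.Gamma (β + 1)) / (1 / Real.Gamma (α + β - 1)) := by
      rw [div_div_eq_mul_div, div_one]; ring
    rw [e2]
    refine h.congr' ?_
    filter_upwards [eventually_gt_atTop 0] with n hn
    have hn' : (0:ℝ) < n := by exact_mod_cast hn
    have hp : (n:ℝ) ^ (1 - (α + β - 1)) = (n:ℝ) ^ (1 - α) * (n:ℝ) ^ (1 - β) := by
      rw [← Real.rpow_add hn']; congr 1; ring
    have p1 := Real.rpow_pos_of_pos hn' (1 - α)
    have p2 := Real.rpow_pos_of_pos hn' (1 - β)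
    have hd := dco_pos hs n
    simp only [Pi.div_apply, hp]
    field_simp
  have hA := abel hs (fun n => g α (n + 1) * g β (n + 1)) hlim
  have hr : Tendsto (fun r : ℝ => r) (nhdsWithin 1 (Set.Iio 1)) (nhds 1) :=
    tendsto_id.mono_left nhdsWithin_le_nhds
  have h := hr.mul hA
  rw [one_mul] at h
  refine h.congr fun r => ?_
  have hsh : hadamardR α β r = ∑' n : ℕ, g α (n + 1) * g β (n + 1) * r ^ (n + 1) := by
    rw [hadamardR]
    symm
    refine Function.Injective.tsum_eq (g := fun n : ℕ => n + 1) (add_left_injective 1)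
      (f := fun n => g α n * g β n * r ^ n) ?_
    intro n hn
    rcases n with _ | n
    · simp [g] at hn
    · exact ⟨n, rfl⟩
  rw [hsh, mul_left_comm, ← tsum_mul_left]
  congr 2; ext n; ring
end
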